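/- arXiv:2605.03712 — 2 statements merged into one kernel-verified Lean document; each statement's English description precedes it below -/
import Mathlib

section
/- Let 0 ≤ λ ≤ λ' ≤ 1 with Z_λ, Z_{λ'} ∈ (0,∞), let ℓ be bounded, and let s, s' > 0. Set c := ∫ π_λ(u) ℓ(u)^{λ'−λ} du. Then c = Z_{λ'} / Z_λ ∈ (0,∞), and for every z' ∈ ℝ^d, ∫∫ η_{λ,s}(z) K_{λ,s}(x ∣ z) (ℓ(x)^{λ'−λ} / c) q_{s'}(z' ∣ x) dx dz = η_{λ',s'}(z'). That is, one ideal Tempered Guided Diffusion stage — exact reconstruction from the noisy marginal, Boltzmann–Gibbs tilting by the incremental likelihood factor, and re-noising at the next noise level — maps the noisy marginal η_{λ,s} exactly to the next noisy marginal η_{λ',s'}. -/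
open MeasureTheory Real

/-- Gaussian noising kernel density `q_s(z ∣ x) = (2π s²)^(−d/2) exp(−‖z − x‖²/(2 s²))`. -/
noncomputable def gaussKernel (d : ℕ) (s : ℝ) (z x : EuclideanSpace ℝ (Fin d)) : ℝ :=
  (2 * π * s ^ 2) ^ (-(d : ℝ) / 2) * Real.exp (-‖z - x‖ ^ 2 / (2 * s ^ 2))

/-- The centred Gaussian profile is integrable with total mass one. -/
lemma gauss_profile (d : ℕ) (s : ℝ) (hs : 0 < s) :
    Integrable (fun v : EuclideanSpace ℝ (Fin d) =>
      (2 * π * s ^ 2) ^ (-(d : ℝ) / 2) * Real.exp (-‖v‖ ^ 2 / (2 * s ^ 2))) ∧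
    (∫ v : EuclideanSpace ℝ (Fin d),
      (2 * π * s ^ 2) ^ (-(d : ℝ) / 2) * Real.exp (-‖v‖ ^ 2 / (2 * s ^ 2))) = 1 := by
  have hb : 0 < 1 / (2 * s ^ 2) := by positivity
  have hA : 0 < 2 * π * s ^ 2 := by positivity
  have e : ∀ v : EuclideanSpace ℝ (Fin d),
      Real.exp (-‖v‖ ^ 2 / (2 * s ^ 2)) = Real.exp (-(1 / (2 * s ^ 2)) * ‖v‖ ^ 2) := by
    intro v
    congr 1
    ring
  simp only [e]
  have h1 : (∫ v : EuclideanSpace ℝ (Fin d),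
      (2 * π * s ^ 2) ^ (-(d : ℝ) / 2) * Real.exp (-(1 / (2 * s ^ 2)) * ‖v‖ ^ 2)) = 1 := by
    rw [integral_const_mul, GaussianFourier.integral_rexp_neg_mul_sq_norm hb]
    have : π / (1 / (2 * s ^ 2)) = 2 * π * s ^ 2 := by
      field_simp
    rw [this, ← Real.rpow_add hA, finrank_euclideanSpace_fin]
    have : -(d : ℝ) / 2 + (d : ℝ) / 2 = 0 := by ring
    rw [this, Real.rpow_zero]
  refine ⟨?_, h1⟩
  by_contra hn
  rw [integral_undef hn] at h1
  exact zero_ne_one h1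

/-- One ideal TGD stage — exact reconstruction from the noisy marginal,
Boltzmann–Gibbs tilting by the incremental likelihood factor `ℓ^{λ'−λ}/c`, and re-noising at
the next noise level — maps the noisy marginal `η_{λ,s}` exactly to `η_{λ',s'}`; moreover the
tilting normalizer is `c = ∫ π_λ ℓ^{λ'−λ} = Z_{λ'} / Z_λ ∈ (0,∞)`. -/
theorem ideal_tgd_stage_maps_noisy_marginal_to_next
    (d : ℕ)
    (p ℓ : EuclideanSpace ℝ (Fin d) → ℝ)
    (hp0 : ∀ x, 0 ≤ p x) (hpmeas : Measurable p)
    (hpint : Integrable p) (hpone : (∫ x, p x) = 1)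
    (hl0 : ∀ x, 0 ≤ ℓ x) (hlmeas : Measurable ℓ)
    (C : ℝ) (hlC : ∀ x, ℓ x ≤ C)
    (lam lam' s s' : ℝ)
    (hlam : 0 ≤ lam) (hlamlam' : lam ≤ lam') (hlam' : lam' ≤ 1)
    (hs : 0 < s) (hs' : 0 < s')
    (Zlam Zlam' : ℝ)
    (hZlamint : Integrable (fun x => p x * ℓ x ^ lam))
    (hZlam'int : Integrable (fun x => p x * ℓ x ^ lam'))
    (hZlam : Zlam = ∫ x, p x * ℓ x ^ lam) (hZlam' : Zlam' = ∫ x, p x * ℓ x ^ lam')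
    (hZlampos : 0 < Zlam) (hZlam'pos : 0 < Zlam')
    (piLam piLam' : EuclideanSpace ℝ (Fin d) → ℝ)
    (hpiLam : ∀ x, piLam x = p x * ℓ x ^ lam / Zlam)
    (hpiLam' : ∀ x, piLam' x = p x * ℓ x ^ lam' / Zlam')
    (η η' : EuclideanSpace ℝ (Fin d) → ℝ)
    (hη : ∀ z, η z = ∫ x, piLam x * gaussKernel d s z x)
    (hη' : ∀ z, η' z = ∫ x, piLam' x * gaussKernel d s' z x)
    (hηpos : ∀ z, 0 < η z) (hη'pos : ∀ z, 0 < η' z)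
    (K : EuclideanSpace ℝ (Fin d) → EuclideanSpace ℝ (Fin d) → ℝ)
    (hK : ∀ x z, K x z = piLam x * gaussKernel d s z x / η z)
    (c : ℝ) (hc : c = ∫ u, piLam u * ℓ u ^ (lam' - lam)) :
    c = Zlam' / Zlam ∧ 0 < c ∧
      ∀ z' : EuclideanSpace ℝ (Fin d),
        (∫ z, ∫ x, η z * K x z * (ℓ x ^ (lam' - lam) / c) * gaussKernel d s' z' x)
          = η' z' := by
  have hcomb : ∀ x, piLam x * ℓ x ^ (lam' - lam) = p x * ℓ x ^ lam' / Zlam := by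
    intro x
    have h := Real.rpow_add_of_nonneg (hl0 x) hlam (sub_nonneg.2 hlamlam')
    rw [add_sub_cancel] at h
    rw [hpiLam, h]
    ring
  have hcZ : c = Zlam' / Zlam := by
    rw [hc, hZlam']
    simp only [hcomb]
    rw [integral_div]
  have hcpos : 0 < c := by rw [hcZ]; positivity
  refine ⟨hcZ, hcpos, ?_⟩
  intro z'
  obtain ⟨hgi, hg1⟩ := gauss_profile d s hs
  have hf : Integrable (fun x => piLam' x * gaussKernel d s' z' x) := by
    have := hη'pos z'
    rw [hη'] at this
    by_contra hn
    rw [integral_undef hn] at this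
    exact lt_irrefl _ this
  have hconv := integral_convolution (ContinuousLinearMap.mul ℝ ℝ) hf hgi
    (μ := volume) (ν := volume)
  rw [hg1] at hconv
  simp only [ContinuousLinearMap.mul_apply', mul_one, convolution] at hconv
  rw [hη', ← hconv]
  congr 1
  funext z
  congr 1
  funext x
  have hz := (hηpos z).ne'
  have h1 : η z * K x z = piLam x * gaussKernel d s z x := by
    rw [hK]; field_simp
  have h2 : piLam x * ℓ x ^ (lam' - lam) / c = piLam' x := by
    rw [hcomb, hpiLam', hcZ]; field_simp
  rw [h1, ← h2]
  simp only [gaussKernel]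
  ring
end

section
/- Exactness of the ideal Tempered Guided Diffusion flow. Let ℓ be bounded and measurable with Z_λ ∈ (0,∞) for all λ ∈ [0,1], let 0 = λ_R ≤ λ_{R−1} ≤ ⋯ ≤ λ_0 = 1 be a tempering schedule and s_R ≥ s_{R−1} ≥ ⋯ ≥ s_0 > 0 a noise schedule. Define, on probability densities, the operators Recon_r(μ)(x) := ∫ μ(z) K_{λ_r,s_r}(x ∣ z) dz, Tilt_r(ρ)(x) := ρ(x) ℓ(x)^{λ_{r−1}−λ_r} / ∫ ρ(u) ℓ(u)^{λ_{r−1}−λ_r} du, and Noise_r(ρ)(z) := ∫ ρ(x) q_{s_{r−1}}(z ∣ x) dx. Initialize μ_R := η_{λ_R, s_R}, which (since λ_R = 0) equals the noised prior z ↦ ∫ p(x) q_{s_R}(z ∣ x) dx, and set μ_{r−1} := Noise_r(Tilt_r(Recon_r(μ_r))) for r = R, …, 1. Then μ_r = η_{λ_r, s_r} for every r = R, …, 0, and the terminal reconstruction satisfies Recon_0(μ_0) = π_1, the posterior density proportional to p·ℓ. Hence the exact-population flow of ideal TGD transforms the noised prior into the posterior. -/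
open MeasureTheory Real

lemma gaussKernel_integral (d : ℕ) (s : ℝ) (hs : 0 < s) (x : EuclideanSpace ℝ (Fin d)) :
    ∫ z, gaussKernel d s z x = 1 := by
  unfold gaussKernel
  rw [integral_const_mul,
    integral_sub_right_eq_self
      (fun z : EuclideanSpace ℝ (Fin d) => Real.exp (-‖z‖ ^ 2 / (2 * s ^ 2))) x]
  have hb : 0 < 1 / (2 * s ^ 2) := by positivity
  have h := GaussianFourier.integral_rexp_neg_mul_sq_norm (V := EuclideanSpace ℝ (Fin d)) hb
  have e : (fun z : EuclideanSpace ℝ (Fin d) => Real.exp (-‖z‖ ^ 2 / (2 * s ^ 2)))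
      = fun z => Real.exp (-(1 / (2 * s ^ 2)) * ‖z‖ ^ 2) := by
    funext z
    congr 1
    ring
  rw [e, h]
  have e2 : π / (1 / (2 * s ^ 2)) = 2 * π * s ^ 2 := by
    field_simp
  have hpos : 0 < 2 * π * s ^ 2 := by positivity
  rw [e2, finrank_euclideanSpace_fin, ← Real.rpow_add hpos]
  have : -(d : ℝ) / 2 + (d : ℝ) / 2 = 0 := by ring
  rw [this, Real.rpow_zero]

/-- Exactness of the ideal Tempered Guided Diffusion flow: initializing
`μ_R = η_{λ_R,s_R}` (which, since `λ_R = 0`, is the noised prior) and iterating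
`μ_{r−1} = Noise_r(Tilt_r(Recon_r(μ_r)))` gives `μ_r = η_{λ_r,s_r}` for every `r = R,…,0`,
and the terminal reconstruction satisfies `Recon_0(μ_0) = π_1`, the posterior density
proportional to `p·ℓ`. -/
theorem ideal_tgd_flow_exact
    (d R : ℕ) (hR : 1 ≤ R)
    (p ℓ : EuclideanSpace ℝ (Fin d) → ℝ)
    (hp0 : ∀ x, 0 ≤ p x) (hpmeas : Measurable p)
    (hpint : Integrable p) (hpone : (∫ x, p x) = 1)
    (hl0 : ∀ x, 0 ≤ ℓ x) (hlmeas : Measurable ℓ)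
    (C : ℝ) (hlC : ∀ x, ℓ x ≤ C)
    (hZ : ∀ lam : ℝ, lam ∈ Set.Icc (0 : ℝ) 1 →
      Integrable (fun x => p x * ℓ x ^ lam) ∧ 0 < ∫ x, p x * ℓ x ^ lam)
    (lam s : ℕ → ℝ)
    (hlamR : lam R = 0) (hlam0 : lam 0 = 1)
    (hlam_mono : ∀ r, r + 1 ≤ R → lam (r + 1) ≤ lam r)
    (hs_mono : ∀ r, r + 1 ≤ R → s r ≤ s (r + 1)) (hs0 : 0 < s 0)
    (piT : ℝ → EuclideanSpace ℝ (Fin d) → ℝ)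
    (hpiT : ∀ (l : ℝ) x, piT l x = p x * ℓ x ^ l / ∫ y, p y * ℓ y ^ l)
    (η : ℝ → ℝ → EuclideanSpace ℝ (Fin d) → ℝ)
    (hη : ∀ (l σ : ℝ) z, η l σ z = ∫ x, piT l x * gaussKernel d σ z x)
    (hηpos : ∀ (l : ℝ), l ∈ Set.Icc (0 : ℝ) 1 → ∀ σ : ℝ, 0 < σ → ∀ z, 0 < η l σ z)
    (K : ℝ → ℝ → EuclideanSpace ℝ (Fin d) → EuclideanSpace ℝ (Fin d) → ℝ)
    (hK : ∀ (l σ : ℝ) x z, K l σ x z = piT l x * gaussKernel d σ z x / η l σ z)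
    (Recon Tilt Noise : ℕ → (EuclideanSpace ℝ (Fin d) → ℝ) →
      EuclideanSpace ℝ (Fin d) → ℝ)
    (hRecon : ∀ r μ x, Recon r μ x = ∫ z, μ z * K (lam r) (s r) x z)
    (hTilt : ∀ r ρ x, Tilt r ρ x =
      ρ x * ℓ x ^ (lam (r - 1) - lam r) / ∫ u, ρ u * ℓ u ^ (lam (r - 1) - lam r))
    (hNoise : ∀ r ρ z, Noise r ρ z = ∫ x, ρ x * gaussKernel d (s (r - 1)) z x)
    (μseq : ℕ → EuclideanSpace ℝ (Fin d) → ℝ)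
    (hμR : μseq R = η (lam R) (s R))
    (hμrec : ∀ r, 1 ≤ r → r ≤ R → μseq (r - 1) = Noise r (Tilt r (Recon r (μseq r)))) :
    (μseq R = fun z => ∫ x, p x * gaussKernel d (s R) z x) ∧
      (∀ r ≤ R, μseq r = η (lam r) (s r)) ∧
      Recon 0 (μseq 0) = piT 1 := by
  have hspos : ∀ r ≤ R, 0 < s r := by
    intro r
    induction r with
    | zero => intro _; exact hs0
    | succ k ih => intro h; exact lt_of_lt_of_le (ih (by omega)) (hs_mono k h)
  have hle1 : ∀ r ≤ R, lam r ≤ 1 := by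
    intro r
    induction r with
    | zero => intro _; exact hlam0.le
    | succ k ih => intro h; exact (hlam_mono k h).trans (ih (by omega))
  have hge0 : ∀ k r, r + k = R → 0 ≤ lam r := by
    intro k
    induction k with
    | zero => intro r h; obtain rfl : r = R := by omega
              exact hlamR.ge
    | succ k ih => intro r h; exact (ih (r + 1) (by omega)).trans (hlam_mono r (by omega))
  have hmem : ∀ r ≤ R, lam r ∈ Set.Icc (0 : ℝ) 1 := fun r h =>
    ⟨hge0 (R - r) r (by omega), hle1 r h⟩
  have hrec : ∀ r ≤ R, Recon r (η (lam r) (s r)) = piT (lam r) := by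
    intro r h
    funext x
    rw [hRecon]
    have : (fun z => η (lam r) (s r) z * K (lam r) (s r) x z)
        = fun z => piT (lam r) x * gaussKernel d (s r) z x := by
      funext z
      rw [hK]
      have := (hηpos _ (hmem r h) _ (hspos r h) z).ne'
      field_simp
    rw [this, integral_const_mul, gaussKernel_integral d _ (hspos r h), mul_one]
  have htilt : ∀ r, r + 1 ≤ R → Tilt (r + 1) (piT (lam (r + 1))) = piT (lam r) := by
    intro r h
    have hZ1 := (hZ _ (hmem (r + 1) h)).2.ne'
    have hZ0 := (hZ _ (hmem r (by omega))).2.ne'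
    have key : ∀ x, piT (lam (r + 1)) x * ℓ x ^ (lam r - lam (r + 1))
        = (∫ y, p y * ℓ y ^ lam (r + 1))⁻¹ * (p x * ℓ x ^ lam r) := by
      intro x
      have e : ℓ x ^ lam r = ℓ x ^ lam (r + 1) * ℓ x ^ (lam r - lam (r + 1)) := by
        rw [← Real.rpow_add_of_nonneg (hl0 x) (hmem (r + 1) h).1
          (sub_nonneg.2 (hlam_mono r h))]
        congr 1
        ring
      rw [hpiT, e]
      ring
    funext x
    rw [hTilt]
    simp only [Nat.add_sub_cancel, key]
    rw [integral_const_mul, hpiT, mul_div_mul_left _ _ (inv_ne_zero hZ1)]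
  have hstep : ∀ k r, r + k = R → μseq r = η (lam r) (s r) := by
    intro k
    induction k with
    | zero => intro r h; obtain rfl : r = R := by omega
              exact hμR
    | succ k ih =>
      intro r h
      have h1 := hμrec (r + 1) (by omega) (by omega)
      rw [Nat.add_sub_cancel] at h1
      rw [h1, ih (r + 1) (by omega), hrec _ (by omega), htilt _ (by omega)]
      funext z
      rw [hNoise, hη, Nat.add_sub_cancel]
  refine ⟨?_, fun r h => hstep (R - r) r (by omega), ?_⟩
  · rw [hμR]
    funext z
    rw [hη]
    simp [hpiT, hlamR, hpone]
  · rw [hstep R 0 (by omega), hrec 0 (by omega), hlam0]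
end
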